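/- Let V be an oriented 4-dimensional real vector space. For every positive volume form dvol ∈ Λ⁴V* and every 3-dimensional positive linear subspace Λ⁺ ⊂ Λ²V* there exists a unique inner product g on V such that dvol_g = dvol and the self-dual 2-forms of g are exactly Λ⁺. -/

import Mathlib

open Matrix MeasureTheory

noncomputable section

/-- Vectors in ℝ⁴. -/
abbrev V4 : Type := Fin 4 → ℝ

/-- 2-forms on ℝ⁴, represented by their (antisymmetric) coefficient matrices. -/
abbrev Mat4 : Type := Matrix (Fin 4) (Fin 4) ℝ

/-- The wedge product of two 2-forms, as the coefficient of dx0∧dx1∧dx2∧dx3. -/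
def w22 (A B : Mat4) : ℝ :=
  A 0 1 * B 2 3 - A 0 2 * B 1 3 + A 0 3 * B 1 2 +
  A 2 3 * B 0 1 - A 1 3 * B 0 2 + A 1 2 * B 0 3

/-- The wedge product of a 1-form and a 3-form (3-forms are written in the
basis σ_m = ι(e_m)(dx0∧dx1∧dx2∧dx3)), as a multiple of dx0∧dx1∧dx2∧dx3. -/
def w13 (l b : V4) : ℝ := l ⬝ᵥ b

/-- The wedge product of a 2-form and a 1-form, as a 3-form in the basis σ_m. -/
def w21 (A : Mat4) (l : V4) : V4 :=
  ![A 1 2 * l 3 - A 1 3 * l 2 + A 2 3 * l 1,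
    -(A 0 2 * l 3 - A 0 3 * l 2 + A 2 3 * l 0),
    A 0 1 * l 3 - A 0 3 * l 1 + A 1 3 * l 0,
    -(A 0 1 * l 2 - A 0 2 * l 1 + A 1 2 * l 0)]

/-- Interior product of a vector with a 2-form. -/
def iota2 (v : V4) (A : Mat4) : V4 := Aᵀ.mulVec v

/-- Interior product of a vector with a 4-form c·dx0∧dx1∧dx2∧dx3. -/
def iota4 (v : V4) (c : ℝ) : V4 := c • v

/-- The metric volume form of the inner product with Gram matrix G, as a
multiple of dx0∧dx1∧dx2∧dx3 (standard orientation). -/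
def volScalar (G : Mat4) : ℝ := Real.sqrt G.det

/-- The inner product with Gram matrix G. -/
def bilin (G : Mat4) (v w : V4) : ℝ := v ⬝ᵥ G.mulVec w

/-- The induced inner product on 1-forms. -/
def ip1 (G : Mat4) (l m : V4) : ℝ := l ⬝ᵥ G⁻¹.mulVec m

/-- The induced inner product on 2-forms. -/
def ip2 (G : Mat4) (A B : Mat4) : ℝ := (1 / 2) * (Aᵀ * G⁻¹ * B * G⁻¹).trace

/-- The wedge-duality involution on 2-forms (the Hodge star of the standard
metric), characterized by w22 A (dual2 B) = ip2 1 A B. -/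
def dual2 (A : Mat4) : Mat4 :=
  !![0, A 2 3, -(A 1 3), A 1 2;
     -(A 2 3), 0, A 0 3, -(A 0 2);
     A 1 3, -(A 0 3), 0, A 0 1;
     -(A 1 2), A 0 2, -(A 0 1), 0]

/-- The Hodge star on 2-forms of the metric with Gram matrix G,
characterized by α ∧ (hodge2 G β) = ⟨α,β⟩_G dvol_G. -/
def hodge2 (G : Mat4) (A : Mat4) : Mat4 := volScalar G • dual2 (G⁻¹ * A * G⁻¹)

/-- The Hodge star Λ¹ → Λ³ of G, characterized by λ ∧ (hodge1 G μ) = ⟨λ,μ⟩_G dvol_G. -/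
def hodge1 (G : Mat4) (m : V4) : V4 := volScalar G • G⁻¹.mulVec m

/-- The Hodge star Λ³ → Λ¹ of G, characterized by hodge1 G (hodge3 G b) = -b. -/
def hodge3 (G : Mat4) (b : V4) : V4 := -((volScalar G)⁻¹ • G.mulVec b)

/-- A complex structure J (J² = -1) is compatible with the standard orientation. -/
def posOrient (J : Mat4) : Prop :=
  ∃ v w : V4, 0 < (Matrix.of fun i k => ![v, J.mulVec v, w, J.mulVec w] k i).det

/-- The inner product on 2-forms induced by the standard metric. -/
def ip2std (A B : Mat4) : ℝ := (1 / 2) * (Aᵀ * B).trace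

/-- The involution R^ρ of the space of 2-forms determined by a
nondegenerate 2-form ρ (with matrix P). -/
def Rmap (P A : Mat4) : Mat4 := A - (w22 A P / (w22 P P / 2)) • P

/-- The standard hyperKähler triple ω₁ = dx0∧dx1 + dx2∧dx3, etc. -/
def sW1 : Mat4 := !![0,1,0,0; -1,0,0,0; 0,0,0,1; 0,0,-1,0]
def sW2 : Mat4 := !![0,0,1,0; 0,0,0,-1; -1,0,0,0; 0,1,0,0]
def sW3 : Mat4 := !![0,0,0,1; 0,0,1,0; 0,-1,0,0; -1,0,0,0]

/-- Two triples in a ring satisfying the polarized Clifford relations `a i * d j + a j * d i = -2 δ`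
and `d i * a j + d j * a i = -2 δ`. -/
structure IsCliffordPair {R : Type*} [Ring R] (a d : Fin 3 → R) : Prop where
  left_self : ∀ i, a i * d i = -1
  right_self : ∀ i, d i * a i = -1
  left_swap : ∀ i j, j < i → a i * d j = -(a j * d i)
  right_swap : ∀ i j, j < i → d i * a j = -(d j * a i)

namespace IsCliffordPair

variable {R : Type*} [Ring R] {a d : Fin 3 → R}

theorem left_self_assoc (h : IsCliffordPair a d) (i : Fin 3) (x : R) :
    a i * (d i * x) = -x := by
  rw [← mul_assoc, h.left_self, neg_one_mul]

theorem right_self_assoc (h : IsCliffordPair a d) (i : Fin 3) (x : R) :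
    d i * (a i * x) = -x := by
  rw [← mul_assoc, h.right_self, neg_one_mul]

theorem left_swap_assoc (h : IsCliffordPair a d) {i j : Fin 3} (hij : j < i) (x : R) :
    a i * (d j * x) = -(a j * (d i * x)) := by
  rw [← mul_assoc, h.left_swap i j hij, neg_mul, mul_assoc]

theorem right_swap_assoc (h : IsCliffordPair a d) {i j : Fin 3} (hij : j < i) (x : R) :
    d i * (a j * x) = -(d j * (a i * x)) := by
  rw [← mul_assoc, h.right_swap i j hij, neg_mul, mul_assoc]

theorem mul_volume (h : IsCliffordPair a d) (i : Fin 3) :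
    a 0 * d 1 * a 2 * d i * (a 0 * d 1 * a 2) = a i := by
  fin_cases i <;>
  simp [mul_assoc, h.left_self_assoc, h.right_self_assoc, h.left_self, h.right_self,
    h.left_swap, h.left_swap_assoc, h.right_swap_assoc]

theorem volume_reverse (h : IsCliffordPair a d) :
    a 2 * d 1 * a 0 = -(a 0 * d 1 * a 2) := by
  simp [mul_assoc,
    h.left_swap, h.right_swap, h.left_swap_assoc]

/-- An element orthogonal to the triple is anti-self-dual. -/
theorem volume_mul_orthogonal (h : IsCliffordPair a d) {b e : R}
    (hl : ∀ i, a i * e = -(b * d i)) (hr : ∀ i, d i * b = -(e * a i)) :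
    a 0 * d 1 * a 2 * e * (a 0 * d 1 * a 2) = -b := by
  have hl' : ∀ i x, a i * (e * x) = -(b * (d i * x)) := fun i x ↦ by
    rw [← mul_assoc, hl, neg_mul, mul_assoc]
  have hr' : ∀ i x, d i * (b * x) = -(e * (a i * x)) := fun i x ↦ by
    rw [← mul_assoc, hr, neg_mul, mul_assoc]
  simp [mul_assoc, h.right_self, hl', hr',
    h.left_swap_assoc, h.right_swap_assoc]

/-- If `(k, g)` intertwines right and left multiplication by the two triples, then multiplying `k`
by the volume element on both sides gives `g`. -/
theorem volume_mul_intertwiner (h : IsCliffordPair a d) {g k : R}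
    (hl : ∀ i, a i * k = g * d i) (hr : ∀ i, k * a i = d i * g) :
    a 0 * d 1 * a 2 * k * (a 0 * d 1 * a 2) = g := by
  have hl' : ∀ i x, a i * (k * x) = g * (d i * x) := fun i x ↦ by
    rw [← mul_assoc, hl, mul_assoc]
  have hr' : ∀ i x, d i * (g * x) = k * (a i * x) := fun i x ↦ by
    rw [← mul_assoc, ← hr, mul_assoc]
  simp [mul_assoc, h.right_self, hl', hr',
    h.left_swap_assoc, h.right_swap_assoc]

theorem quaternion_mul_volume [Algebra ℝ R] (h : IsCliffordPair a d) (x : Fin 4 → ℝ) :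
    (x 0 • 1 + x 1 • (a 2 * d 1) + x 2 • (a 0 * d 2) + x 3 • (a 1 * d 0)) * (a 0 * d 1 * a 2) *
      (x 0 • 1 + x 1 • (d 1 * a 2) + x 2 • (d 2 * a 0) + x 3 • (d 0 * a 1)) =
    (x 0 ^ 2 + x 1 ^ 2 + x 2 ^ 2 + x 3 ^ 2) • (a 0 * d 1 * a 2) := by
  have h01 : (0 : Fin 3) < 1 := by decide
  have h02 : (0 : Fin 3) < 2 := by decide
  have h12 : (1 : Fin 3) < 2 := by decide
  simp only [mul_add, add_mul, smul_mul_assoc, mul_smul_comm, one_mul, mul_one]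
  simp only [mul_assoc, h.left_self_assoc, h.right_self,
    h.left_swap, h.right_swap, h.left_swap_assoc, h.right_swap_assoc,
    h01, h02, h12, mul_neg, neg_mul, mul_one, neg_neg]
  module

end IsCliffordPair

theorem dual2_add (A B : Mat4) : dual2 (A + B) = dual2 A + dual2 B := by
  ext i j
  fin_cases i <;> fin_cases j <;> simp [dual2] <;> ring

theorem dual2_smul (r : ℝ) (A : Mat4) : dual2 (r • A) = r • dual2 A := by
  ext i j
  fin_cases i <;> fin_cases j <;> simp [dual2]

theorem transpose_dual2 (A : Mat4) : (dual2 A)ᵀ = -dual2 A := by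
  ext i j
  fin_cases i <;> fin_cases j <;> simp [dual2]

/-- Antisymmetric matrices are determined by their upper triangle. -/
theorem eq_of_transpose_eq_neg {A : Mat4} (hA : Aᵀ = -A) :
    A = !![0, A 0 1, A 0 2, A 0 3; -(A 0 1), 0, A 1 2, A 1 3;
      -(A 0 2), -(A 1 2), 0, A 2 3; -(A 0 3), -(A 1 3), -(A 2 3), 0] := by
  have h : ∀ i j, A j i = -A i j := fun i j ↦ congrFun (congrFun hA i) j
  have h0 : ∀ i, A i i = 0 := fun i ↦ by linarith [h i i]
  ext i j
  fin_cases i <;> fin_cases j <;> simp [h0] <;> exact h _ _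

theorem mul_dual2_add_mul_dual2 {A B : Mat4} (hA : Aᵀ = -A) (hB : Bᵀ = -B) :
    A * dual2 B + B * dual2 A = -(w22 A B • 1) := by
  rw [eq_of_transpose_eq_neg hA, eq_of_transpose_eq_neg hB]
  ext i j
  fin_cases i <;> fin_cases j <;> simp [dual2, w22] <;> ring

theorem dual2_mul_add_dual2_mul {A B : Mat4} (hA : Aᵀ = -A) (hB : Bᵀ = -B) :
    dual2 A * B + dual2 B * A = -(w22 A B • 1) := by
  have h := congrArg Matrix.transpose (mul_dual2_add_mul_dual2 hB hA)
  have hw : w22 B A = w22 A B := by simp only [w22]; ring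
  simpa [transpose_dual2, hA, hB, hw] using h

theorem det_dual2 {A : Mat4} (hA : Aᵀ = -A) : (dual2 A).det = A.det := by
  rw [eq_of_transpose_eq_neg hA]
  simp [dual2, Matrix.det_succ_row_zero, Fin.sum_univ_succ, Fin.succAbove]
  ring

set_option maxHeartbeats 4000000 in
theorem transpose_mul_dual2_conj (M : Mat4) {A : Mat4} (hA : Aᵀ = -A) :
    Mᵀ * dual2 (M * A * Mᵀ) * M = M.det • dual2 A := by
  rw [eq_of_transpose_eq_neg hA]
  ext i j
  fin_cases i <;> fin_cases j <;>
    simp [dual2, Matrix.mul_apply, Matrix.det_succ_row_zero, Fin.sum_univ_succ,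
      Fin.succAbove] <;> ring

theorem hodge2_eq {G : Mat4} (hG : G.PosDef) {A : Mat4} (hA : Aᵀ = -A) :
    hodge2 G A = (volScalar G)⁻¹ • (G * dual2 A * G) := by
  have hu : IsUnit G.det := hG.det_pos.ne'.isUnit
  have hsymm : Gᵀ = G := by simpa using hG.isHermitian.eq
  have h := transpose_mul_dual2_conj G⁻¹ hA
  rw [Matrix.transpose_nonsing_inv, hsymm, Matrix.det_nonsing_inv, Ring.inverse_eq_inv'] at h
  have hd : dual2 (G⁻¹ * A * G⁻¹) = G.det⁻¹ • (G * dual2 A * G) := by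
    calc dual2 (G⁻¹ * A * G⁻¹)
        = G * (G⁻¹ * dual2 (G⁻¹ * A * G⁻¹) * G⁻¹) * G := by
          rw [mul_assoc G⁻¹ (dual2 _), Matrix.mul_nonsing_inv_cancel_left _ _ hu,
            Matrix.nonsing_inv_mul_cancel_right _ _ hu]
      _ = G.det⁻¹ • (G * dual2 A * G) := by simp [h]
  have hv : volScalar G * G.det⁻¹ = (volScalar G)⁻¹ := by
    rw [volScalar, ← div_eq_mul_inv, Real.sqrt_div_self]
  rw [hodge2, hd, smul_smul, hv]

/-- The 2-forms `A` with `G * dual2 A * G = c • A`; for a metric `G` of volume `c` these are the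
self-dual ones. -/
def selfDual (G : Mat4) (c : ℝ) : Submodule ℝ Mat4 where
  carrier := {A | G * dual2 A * G = c • A}
  add_mem' {A B} hA hB := by
    simp only [Set.mem_ofPred_eq] at *
    rw [dual2_add, mul_add, add_mul, hA, hB, smul_add]
  zero_mem' := by
    have h := dual2_smul 0 0
    simp only [zero_smul] at h
    simp [h]
  smul_mem' r A hA := by
    simp only [Set.mem_ofPred_eq] at *
    rw [dual2_smul, mul_smul_comm, smul_mul_assoc, hA, smul_comm]

theorem mem_selfDual {G A : Mat4} {c : ℝ} : A ∈ selfDual G c ↔ G * dual2 A * G = c • A := Iff.rfl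

theorem hodge2_eq_self_iff {G : Mat4} (hG : G.PosDef) {A : Mat4} (hA : Aᵀ = -A) :
    hodge2 G A = A ↔ A ∈ selfDual G (volScalar G) := by
  have hv : volScalar G ≠ 0 := (Real.sqrt_pos.mpr hG.det_pos).ne'
  rw [hodge2_eq hG hA, mem_selfDual, inv_smul_eq_iff₀ hv]

/-- The wedge product of 2-forms as a bilinear form. -/
def wedgeForm : LinearMap.BilinForm ℝ Mat4 :=
  LinearMap.mk₂ ℝ w22
    (fun A B C ↦ by simp only [w22, Matrix.add_apply]; ring)
    (fun r A B ↦ by simp only [w22, Matrix.smul_apply, smul_eq_mul]; ring)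
    (fun A B C ↦ by simp only [w22, Matrix.add_apply]; ring)
    (fun r A B ↦ by simp only [w22, Matrix.smul_apply, smul_eq_mul]; ring)

theorem wedgeForm_apply (A B : Mat4) : wedgeForm A B = w22 A B := rfl

theorem w22_comm (A B : Mat4) : w22 A B = w22 B A := by
  simp only [w22]; ring

theorem exists_orthonormal_spanning {L : Submodule ℝ Mat4} (hLdim : Module.finrank ℝ L = 3)
    (hLpos : ∀ A ∈ L, A ≠ 0 → 0 < w22 A A) :
    ∃ a : Fin 3 → Mat4, (∀ i j, w22 (a i) (a j) = if i = j then 2 else 0) ∧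
      L = Submodule.span ℝ (Set.range a) := by
  have hsymm : LinearMap.IsSymm (wedgeForm.restrict L) := ⟨fun A B ↦ w22_comm A B⟩
  obtain ⟨v, hv⟩ := LinearMap.BilinForm.exists_orthogonal_basis (B := wedgeForm.restrict L) hsymm
  let e := finCongr hLdim
  let b : Fin 3 → Mat4 := fun i ↦ v (e.symm i)
  have hb (i : Fin 3) : 0 < w22 (b i) (b i) :=
    hLpos _ (v (e.symm i)).2 fun h ↦ v.ne_zero (e.symm i) (Subtype.ext h)
  have hbo (i j : Fin 3) (hij : i ≠ j) : w22 (b i) (b j) = 0 :=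
    hv fun h ↦ hij (e.symm.injective h)
  let r : Fin 3 → ℝ := fun i ↦ Real.sqrt (2 / w22 (b i) (b i))
  have hr (i : Fin 3) : r i ≠ 0 := (Real.sqrt_pos.mpr (div_pos two_pos (hb i))).ne'
  refine ⟨fun i ↦ r i • b i, fun i j ↦ ?_, le_antisymm (fun A hA ↦ ?_) ?_⟩
  · rw [← wedgeForm_apply, map_smul, map_smul, LinearMap.smul_apply, wedgeForm_apply, smul_comm]
    split_ifs with hij
    · subst hij
      rw [smul_eq_mul, smul_eq_mul, ← mul_assoc,
        Real.mul_self_sqrt (div_pos two_pos (hb i)).le, div_mul_cancel₀ _ (hb i).ne']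
    · rw [hbo i j hij, smul_zero, smul_zero]
  · have hsum := congrArg L.subtype (v.sum_repr ⟨A, hA⟩)
    rw [map_sum] at hsum
    change _ = A at hsum
    rw [← hsum]
    refine Submodule.sum_mem _ fun k _ ↦ ?_
    rw [map_smul]
    refine Submodule.smul_mem _ _ ?_
    have hk : L.subtype (v k) = (r (e k))⁻¹ • (r (e k) • b (e k)) := by
      rw [inv_smul_smul₀ (hr _)]
      simp [b]
    rw [hk]
    exact Submodule.smul_mem _ _ (Submodule.subset_span ⟨e k, rfl⟩)
  · rw [Submodule.span_le]
    rintro _ ⟨i, rfl⟩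
    exact L.smul_mem _ (v (e.symm i)).2

theorem isCliffordPair_dual2 {a : Fin 3 → Mat4} (ha : ∀ i, (a i)ᵀ = -a i)
    (hw : ∀ i j, w22 (a i) (a j) = if i = j then 2 else 0) :
    IsCliffordPair a (fun i ↦ dual2 (a i)) where
  left_self i := by
    have h := mul_dual2_add_mul_dual2 (ha i) (ha i)
    rw [hw, if_pos rfl] at h
    have h2 : (2 : ℝ) • (a i * dual2 (a i) + 1) = 0 := by
      rw [smul_add, two_smul, h, neg_add_cancel]
    exact eq_neg_of_add_eq_zero_left ((smul_eq_zero.mp h2).resolve_left two_ne_zero)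
  right_self i := by
    have h := dual2_mul_add_dual2_mul (ha i) (ha i)
    rw [hw, if_pos rfl] at h
    have h2 : (2 : ℝ) • (dual2 (a i) * a i + 1) = 0 := by
      rw [smul_add, two_smul, h, neg_add_cancel]
    exact eq_neg_of_add_eq_zero_left ((smul_eq_zero.mp h2).resolve_left two_ne_zero)
  left_swap i j hij := by
    have h := mul_dual2_add_mul_dual2 (ha i) (ha j)
    rw [hw, if_neg hij.ne', zero_smul, neg_zero] at h
    exact eq_neg_of_add_eq_zero_left h
  right_swap i j hij := by
    have h := dual2_mul_add_dual2_mul (ha i) (ha j)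
    rw [hw, if_neg hij.ne', zero_smul, neg_zero] at h
    exact eq_neg_of_add_eq_zero_left h

/-- The volume element of a Clifford pair of antisymmetric matrices is a definite form. -/
theorem exists_posDef_smul_volume {a d : Fin 3 → Mat4} (h : IsCliffordPair a d)
    (ha : ∀ i, (a i)ᵀ = -a i) (hd : ∀ i, (d i)ᵀ = -d i) :
    ∃ ε : ℝ, ε * ε = 1 ∧ (ε • (a 0 * d 1 * a 2)).PosDef := by
  set S := a 0 * d 1 * a 2 with hS
  have hsymm : Sᵀ = S := by
    rw [hS, Matrix.transpose_mul, Matrix.transpose_mul, ha, ha, hd, ← mul_assoc]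
    simpa using congrArg Neg.neg h.volume_reverse
  let Q : V4 → ℝ := fun x ↦ x ⬝ᵥ S *ᵥ x
  let T : V4 → Mat4 := fun x ↦
    x 0 • 1 + x 1 • (d 1 * a 2) + x 2 • (d 2 * a 0) + x 3 • (d 0 * a 1)
  have hT (x : V4) : (T x)ᵀ * S * T x = (x 0 ^ 2 + x 1 ^ 2 + x 2 ^ 2 + x 3 ^ 2) • S := by
    rw [← h.quaternion_mul_volume x]
    simp [T, hS, ha, hd, Matrix.transpose_mul]
  have hker (w : V4) (hw : S *ᵥ w = 0) : w = 0 := by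
    have h2 : S * d 0 * S = a 0 := h.mul_volume 0
    have h3 : (-(d 0 * S * d 0)) * S = 1 := by
      rw [neg_mul, mul_assoc (d 0), mul_assoc (d 0), h2, h.right_self, neg_neg]
    rw [← Matrix.one_mulVec w, ← h3, ← Matrix.mulVec_mulVec, hw, Matrix.mulVec_zero]
  let u : V4 := Pi.single 0 1
  have hu : u ≠ 0 := by simp [u]
  let f : V4 →ₗ[ℝ] V4 :=
    { toFun := fun x ↦ T x *ᵥ u
      map_add' := fun x y ↦ by
        rw [← Matrix.add_mulVec]
        congr 1
        simp only [T, Pi.add_apply]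
        module
      map_smul' := fun r x ↦ by
        rw [RingHom.id_apply, ← Matrix.smul_mulVec]
        congr 1
        simp only [T, Pi.smul_apply, smul_eq_mul]
        module }
  have hfQ (x : V4) : Q (f x) = (x 0 ^ 2 + x 1 ^ 2 + x 2 ^ 2 + x 3 ^ 2) * Q u := by
    have := congrArg (fun M : Mat4 ↦ u ⬝ᵥ M *ᵥ u) (hT x)
    simp only [Matrix.smul_mulVec, dotProduct_smul, smul_eq_mul, ← Matrix.mulVec_mulVec] at this
    rw [← this, Matrix.dotProduct_mulVec u, Matrix.vecMul_transpose]
    rfl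
  have hpos (x : V4) (hx : x ≠ 0) : 0 < x 0 ^ 2 + x 1 ^ 2 + x 2 ^ 2 + x 3 ^ 2 := by
    have h0 : 0 ≤ x 0 ^ 2 + x 1 ^ 2 + x 2 ^ 2 + x 3 ^ 2 := by positivity
    refine h0.lt_of_ne fun h0 ↦ hx ?_
    ext i
    fin_cases i <;> simp <;>
      nlinarith [sq_nonneg (x 0), sq_nonneg (x 1), sq_nonneg (x 2), sq_nonneg (x 3)]
  have hinj : Function.Injective f := by
    rw [← LinearMap.ker_eq_bot, LinearMap.ker_eq_bot']
    intro x hx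
    by_contra hx0
    have := congrArg (fun M : Mat4 ↦ M *ᵥ u) (hT x)
    simp only [← Matrix.mulVec_mulVec, Matrix.smul_mulVec] at this
    rw [show T x *ᵥ u = 0 from hx, Matrix.mulVec_zero, Matrix.mulVec_zero] at this
    exact hu (hker u ((smul_eq_zero.mp this.symm).resolve_left (hpos x hx0).ne'))
  have hsurj : Function.Surjective f := LinearMap.injective_iff_surjective.mp hinj
  have hQu : Q u ≠ 0 := by
    intro h0
    have hQ (w : V4) : Q w = 0 := by
      obtain ⟨x, rfl⟩ := hsurj w
      rw [hfQ, h0, mul_zero]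
    have hpol (v w : V4) : v ⬝ᵥ S *ᵥ w = 0 := by
      have h1 := hQ (v + w)
      have h2 : w ⬝ᵥ S *ᵥ v = v ⬝ᵥ S *ᵥ w := by
        rw [Matrix.dotProduct_mulVec, ← Matrix.mulVec_transpose, hsymm, dotProduct_comm]
      have h3 := hQ v
      have h4 := hQ w
      simp only [Q, Matrix.mulVec_add, dotProduct_add, add_dotProduct] at h1 h3 h4
      linarith
    exact hu (hker u (dotProduct_eq_zero _ fun w ↦ by rw [dotProduct_comm]; exact hpol w u))
  have key (ε : ℝ) (hε : 0 < ε * Q u) : (ε • S).PosDef := by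
    refine Matrix.PosDef.of_dotProduct_mulVec_pos ?_ fun w hw ↦ ?_
    · rw [Matrix.IsHermitian, Matrix.conjTranspose_eq_transpose_of_trivial, Matrix.transpose_smul,
        hsymm]
    · obtain ⟨x, rfl⟩ := hsurj w
      have hx : x ≠ 0 := fun hx ↦ hw (by rw [hx, map_zero])
      have : star (f x) ⬝ᵥ (ε • S) *ᵥ f x =
          (x 0 ^ 2 + x 1 ^ 2 + x 2 ^ 2 + x 3 ^ 2) * (ε * Q u) := by
        rw [star_trivial, Matrix.smul_mulVec, dotProduct_smul, smul_eq_mul, mul_left_comm, ← hfQ]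
      rw [this]
      exact mul_pos (hpos x hx) hε
  rcases hQu.lt_or_gt with hneg | hgt
  · exact ⟨-1, by norm_num, key _ (by linarith)⟩
  · exact ⟨1, by norm_num, key _ (by linarith)⟩

/-- A positive definite matrix is the geometric mean `√c • P` once `c • P * G⁻¹ * P = G`. -/
theorem eq_sqrt_smul_of_posDef {n : Type*} [Fintype n] [DecidableEq n] {G P : Matrix n n ℝ}
    (hG : G.PosDef) (hP : P.PosDef) {c : ℝ} (hc : 0 < c) (h : c • (P * G⁻¹ * P) = G) :
    G = Real.sqrt c • P := by
  have hs : 0 < Real.sqrt c := Real.sqrt_pos.mpr hc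
  have hsum : (Real.sqrt c • P + G).PosDef := (hP.smul hs).add hG
  have hu : IsUnit G.det := hG.det_pos.ne'.isUnit
  have husum : IsUnit (Real.sqrt c • P + G) := hsum.isUnit
  have hz : (Real.sqrt c • P - G) * G⁻¹ * (Real.sqrt c • P + G) = 0 := by
    have h1 : (Real.sqrt c • P) * G⁻¹ * (Real.sqrt c • P) = G := by
      rw [smul_mul_assoc, smul_mul_assoc, mul_smul_comm, smul_smul, Real.mul_self_sqrt hc.le, h]
    rw [sub_mul, Matrix.mul_nonsing_inv _ hu, sub_mul, mul_add, h1,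
      Matrix.nonsing_inv_mul_cancel_right _ _ hu, one_mul]
    abel
  have h_half : (Real.sqrt c • P - G) * G⁻¹ = 0 := (husum.mul_left_eq_zero).mp hz
  have h_diff := congrArg (· * G) h_half
  simp only [Matrix.nonsing_inv_mul_cancel_right _ _ hu, zero_mul] at h_diff
  exact (sub_eq_zero.mp h_diff).symm

/-- A 2-form orthogonal to a self-dual orthonormal triple is anti-self-dual, so it vanishes once it
is self-dual itself. -/
theorem mem_span_of_mem_selfDual {a : Fin 3 → Mat4} (ha : ∀ i, (a i)ᵀ = -a i)
    (hw : ∀ i j, w22 (a i) (a j) = if i = j then 2 else 0) {c ε : ℝ} (hc : 0 < c)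
    (hε : ε * ε = 1) {G : Mat4} (hG : G = (Real.sqrt c * ε) • (a 0 * dual2 (a 1) * a 2))
    (hspan : Submodule.span ℝ (Set.range a) ≤ selfDual G c) {A : Mat4} (hA : Aᵀ = -A)
    (hAG : A ∈ selfDual G c) : A ∈ Submodule.span ℝ (Set.range a) := by
  have h := isCliffordPair_dual2 ha hw
  set p : Mat4 := ∑ i, (w22 A (a i) / 2) • a i with hp
  have hpL : p ∈ Submodule.span ℝ (Set.range a) :=
    Submodule.sum_mem _ fun i _ ↦ Submodule.smul_mem _ _ (Submodule.subset_span ⟨i, rfl⟩)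
  have hpt : pᵀ = -p := by simp [hp, Matrix.transpose_sum, ha]
  have hbt : (A - p)ᵀ = -(A - p) := by rw [Matrix.transpose_sub, hA, hpt]; abel
  have hwb (i : Fin 3) : w22 (a i) (A - p) = 0 := by
    rw [← wedgeForm_apply, map_sub, hp, map_sum]
    simp [wedgeForm_apply, hw, w22_comm (a i) A]
  have hneg : a 0 * dual2 (a 1) * a 2 * dual2 (A - p) * (a 0 * dual2 (a 1) * a 2) = -(A - p) := by
    refine h.volume_mul_orthogonal (fun i ↦ ?_) (fun i ↦ ?_)
    · have := mul_dual2_add_mul_dual2 (ha i) hbt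
      rw [hwb, zero_smul, neg_zero] at this
      exact eq_neg_of_add_eq_zero_left this
    · have := dual2_mul_add_dual2_mul (ha i) hbt
      rw [hwb, zero_smul, neg_zero] at this
      exact eq_neg_of_add_eq_zero_left this
  have hself : G * dual2 (A - p) * G = c • (A - p) :=
    mem_selfDual.mp (Submodule.sub_mem _ hAG (hspan hpL))
  have hsc : Real.sqrt c * ε * (Real.sqrt c * ε) = c := by
    rw [mul_mul_mul_comm, Real.mul_self_sqrt hc.le, hε, mul_one]
  rw [hG, smul_mul_assoc, smul_mul_assoc, mul_smul_comm, smul_smul, hsc, hneg] at hself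
  have hn : -(A - p) = A - p := smul_right_injective _ hc.ne' hself
  have h2 : (2 : ℝ) • (A - p) = 0 := by
    rw [two_smul]
    exact eq_neg_iff_add_eq_zero.mp hn.symm
  have hz : A - p = 0 := (smul_eq_zero.mp h2).resolve_left two_ne_zero
  rwa [sub_eq_zero.mp hz]

/-- Theorem DONfour: for every positive volume form c·dx0123
(c > 0) and every 3-dimensional positive subspace Λ⁺ of the 2-forms, there is
a unique inner product g with dvol_g = c·dx0123 whose self-dual 2-forms are
exactly Λ⁺. -/
theorem unique_metric_from_volume_and_selfdual (c : ℝ) (hc : 0 < c)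
    (L : Submodule ℝ Mat4) (hLanti : ∀ A ∈ L, Aᵀ = -A)
    (hLdim : Module.finrank ℝ L = 3)
    (hLpos : ∀ A ∈ L, A ≠ 0 → 0 < w22 A A) :
    ∃! G : Mat4, G.PosDef ∧ volScalar G = c ∧
      ∀ A : Mat4, Aᵀ = -A → (hodge2 G A = A ↔ A ∈ L) := by
  obtain ⟨a, hw, hL⟩ := exists_orthonormal_spanning hLdim hLpos
  have haL (i : Fin 3) : a i ∈ L := hL ▸ Submodule.subset_span ⟨i, rfl⟩
  have ha (i : Fin 3) : (a i)ᵀ = -a i := hLanti _ (haL i)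
  have h := isCliffordPair_dual2 ha hw
  obtain ⟨ε, hε, hP⟩ := exists_posDef_smul_volume h ha fun i ↦ transpose_dual2 (a i)
  set S := a 0 * dual2 (a 1) * a 2 with hS
  have hs : 0 < Real.sqrt c := Real.sqrt_pos.mpr hc
  have hPdual (i : Fin 3) : (ε • S) * dual2 (a i) * (ε • S) = a i := by
    rw [smul_mul_assoc, smul_mul_assoc, mul_smul_comm, smul_smul, hε, one_smul]
    exact h.mul_volume i
  have hPdet : (ε • S).det = 1 := by
    have h1 := congrArg Matrix.det (hPdual 0)
    have h2 := congrArg Matrix.det (h.left_self 0)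
    rw [Matrix.det_mul, Matrix.det_mul, det_dual2 (ha 0)] at h1
    rw [Matrix.det_mul, det_dual2 (ha 0)] at h2
    have h3 : (a 0).det ≠ 0 := fun h0 ↦ by
      rw [h0, mul_zero, Matrix.det_neg, Matrix.det_one] at h2
      norm_num at h2
    have h4 : (ε • S).det * (ε • S).det = 1 := mul_right_cancel₀ h3 (by linarith)
    nlinarith [hP.det_pos]
  have hsol : Real.sqrt c • (ε • S) = (Real.sqrt c * ε) • S := smul_smul _ _ _
  have hvol : volScalar (Real.sqrt c • (ε • S)) = c := by
    rw [volScalar, Matrix.det_smul, hPdet, mul_one, Fintype.card_fin,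
      show Real.sqrt c ^ 4 = (Real.sqrt c ^ 2) ^ 2 by ring, Real.sq_sqrt hc.le, Real.sqrt_sq hc.le]
  have hspan : L ≤ selfDual (Real.sqrt c • (ε • S)) c := by
    rw [hL, Submodule.span_le]
    rintro _ ⟨i, rfl⟩
    refine mem_selfDual.mpr ?_
    rw [smul_mul_assoc, smul_mul_assoc, mul_smul_comm, smul_smul, Real.mul_self_sqrt hc.le, hPdual]
  refine ⟨Real.sqrt c • (ε • S), ⟨hP.smul hs, ?_, fun A hA ↦ ?_⟩, fun G ⟨hG, hGc, hGL⟩ ↦ ?_⟩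
  · exact hvol
  · rw [hodge2_eq_self_iff (hP.smul hs) hA, hvol]
    refine ⟨fun hAG ↦ ?_, fun hAL ↦ hspan hAL⟩
    rw [hL] at hspan ⊢
    exact mem_span_of_mem_selfDual ha hw hc hε hsol hspan hA hAG
  · refine eq_sqrt_smul_of_posDef hG hP hc ?_
    have hu : IsUnit G.det := hG.det_pos.ne'.isUnit
    have hGa (i : Fin 3) : G * dual2 (a i) * G = c • a i :=
      hGc ▸ mem_selfDual.mp ((hodge2_eq_self_iff hG (ha i)).mp ((hGL _ (ha i)).mpr (haL i)))
    have hGS : S * (c • G⁻¹) * S = G := by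
      refine h.volume_mul_intertwiner (fun i ↦ ?_) (fun i ↦ ?_)
      · rw [mul_smul_comm, ← smul_mul_assoc, ← hGa, Matrix.mul_nonsing_inv_cancel_right _ _ hu]
      · rw [smul_mul_assoc, ← mul_smul_comm, ← hGa, mul_assoc,
          Matrix.nonsing_inv_mul_cancel_left _ _ hu]
    rw [smul_mul_assoc, smul_mul_assoc, mul_smul_comm, smul_smul ε, hε, one_smul]
    simpa using hGS


end
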